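/- Let D be a digraph and k > 0 an integer. Suppose the maximum in-degree Δ⁻(D) is at most k, the fractional arboricity Υ₁(D) is at most k, and set c = k·|V(D)| − |E(D)|. Then the arc set of D can be partitioned into k branchings, each of which has exactly ⌊c/k⌋ or exactly ⌈c/k⌉ roots. -/

import Mathlib

open Finset

section BranchSetup

variable {V A : Type} [Fintype V] [DecidableEq V] [Fintype A] [DecidableEq A]

/-- One arc-step within the arc set `B` of the digraph `D = (V, A)`. -/
def DStep (tl hd : A → V) (B : Finset A) (u v : V) : Prop :=
  ∃ a ∈ B, tl a = u ∧ hd a = v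

/-- `B` is a branching: every vertex has in-degree at most one in `B` and `B`
contains no (directed) cycle; equivalently each component of the spanning
subdigraph `(V, B)` is an arborescence. -/
def IsBranching (tl hd : A → V) (B : Finset A) : Prop :=
  (∀ a ∈ B, ∀ b ∈ B, hd a = hd b → a = b) ∧
  (∀ v : V, ¬ Relation.TransGen (DStep tl hd B) v v)

/-- The root set `R(B)` of a branching: the vertices of in-degree zero, i.e.
the roots of the arborescence components. -/
def roots (hd : A → V) (B : Finset A) : Finset V :=
  Finset.univ.filter fun v => ∀ a ∈ B, hd a ≠ v

/-- `d⁻_{A₀}(X)`: the number of arcs of `A₀` with head in `X` and tail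
outside of `X`. -/
def dInD (tl hd : A → V) (A₀ : Finset A) (X : Finset V) : ℕ :=
  (A₀.filter fun a => hd a ∈ X ∧ tl a ∉ X).card

end BranchSetup

section DisjointBranchings

variable {V A ι : Type} [DecidableEq V] [Fintype ι]

/-- The number of members of the family `R` which are disjoint from `X`. -/
def missCount (R : ι → Finset V) (X : Finset V) : ℕ :=
  (Finset.univ.filter fun i => Disjoint (R i) X).card

theorem dInD_inter_add_union_le (tl hd : A → V) (A₀ : Finset A) (X Y : Finset V) :
    dInD tl hd A₀ (X ∩ Y) + dInD tl hd A₀ (X ∪ Y) ≤ dInD tl hd A₀ X + dInD tl hd A₀ Y := by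
  simp only [dInD, Finset.card_filter, ← Finset.sum_add_distrib]
  refine Finset.sum_le_sum fun a _ => ?_
  by_cases h1 : hd a ∈ X <;> by_cases h2 : hd a ∈ Y <;> by_cases h3 : tl a ∈ X <;>
    by_cases h4 : tl a ∈ Y <;> simp [h1, h2, h3, h4]

theorem ite_disjoint_add_le (S X Y : Finset V) :
    (if Disjoint S X then 1 else 0) + (if Disjoint S Y then 1 else 0) ≤
      (if Disjoint S (X ∩ Y) then 1 else 0) + (if Disjoint S (X ∪ Y) then 1 else 0) := by
  have hX : Disjoint S X → Disjoint S (X ∩ Y) := fun h => h.mono_right Finset.inter_subset_left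
  have hY : Disjoint S Y → Disjoint S (X ∩ Y) := fun h => h.mono_right Finset.inter_subset_right
  by_cases h1 : Disjoint S X <;> by_cases h2 : Disjoint S Y <;>
    simp [h1, h2, hX, hY, Finset.disjoint_union_right]

/-- Supermodularity of `missCount`. -/
theorem missCount_add_le (R : ι → Finset V) (X Y : Finset V) :
    missCount R X + missCount R Y ≤ missCount R (X ∩ Y) + missCount R (X ∪ Y) := by
  simp only [missCount, Finset.card_filter, ← Finset.sum_add_distrib]
  exact Finset.sum_le_sum fun j _ => ite_disjoint_add_le (R j) X Y

/-- Supermodularity of `missCount` is strict if some member of the family meets both sets but not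
their intersection. -/
theorem missCount_add_lt (R : ι → Finset V) (X Y : Finset V) (i : ι)
    (hX : ¬ Disjoint (R i) X) (hY : ¬ Disjoint (R i) Y) (hXY : Disjoint (R i) (X ∩ Y)) :
    missCount R X + missCount R Y < missCount R (X ∩ Y) + missCount R (X ∪ Y) := by
  simp only [missCount, Finset.card_filter, ← Finset.sum_add_distrib]
  refine Finset.sum_lt_sum (fun j _ => ite_disjoint_add_le (R j) X Y) ⟨i, Finset.mem_univ i, ?_⟩
  simp [hX, hY, hXY]

theorem dInD_union [DecidableEq A] (tl hd : A → V) {B C : Finset A} (h : Disjoint B C) (X : Finset V) :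
    dInD tl hd (B ∪ C) X = dInD tl hd B X + dInD tl hd C X := by
  rw [dInD, Finset.filter_union, Finset.card_union_of_disjoint (Finset.disjoint_filter_filter h)]
  rfl

theorem missCount_bool (R S X : Finset V) :
    missCount (fun b : Bool => cond b R S) X =
      (if Disjoint R X then 1 else 0) + (if Disjoint S X then 1 else 0) := by
  rw [missCount, Finset.card_filter, Fintype.sum_bool]
  rfl

/-- In the situation of Edmonds' theorem, an unfinished root set can be enlarged along an arc that
can be spared. -/
theorem exists_spare_arc [Fintype V] (tl hd : A → V) (A₀ : Finset A) (R : ι → Finset V)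
    (h : ∀ X : Finset V, X.Nonempty → missCount R X ≤ dInD tl hd A₀ X)
    (i : ι) (hi : R i ≠ Finset.univ) :
    ∃ a ∈ A₀, tl a ∈ R i ∧ hd a ∉ R i ∧
      ∀ Y : Finset V, hd a ∈ Y → tl a ∉ Y → ¬ Disjoint (R i) Y →
        missCount R Y < dInD tl hd A₀ Y := by
  obtain ⟨w, hw⟩ : ∃ w, w ∉ R i := by
    by_contra! hall
    exact hi (Finset.eq_univ_iff_forall.2 hall)
  let F : Finset (Finset V) := Finset.univ.filter fun X =>
    missCount R X = dInD tl hd A₀ X ∧ ¬ Disjoint (R i) X ∧ ∃ x ∈ X, x ∉ R i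
  have hF : F.Nonempty := by
    refine ⟨Finset.univ, ?_⟩
    have h0 : dInD tl hd A₀ Finset.univ = 0 := by simp [dInD]
    have h1 := h Finset.univ ⟨w, Finset.mem_univ w⟩
    have h2 : missCount R Finset.univ = 0 := by omega
    simp only [F, Finset.mem_filter, Finset.mem_univ, true_and]
    refine ⟨by omega, fun hd0 => ?_, w, hw⟩
    rw [missCount, Finset.card_eq_zero] at h2
    exact Finset.notMem_empty i (h2 ▸ Finset.mem_filter.2 ⟨Finset.mem_univ i, hd0⟩)
  obtain ⟨X, hXF, hmin⟩ := Finset.exists_min_image F Finset.card hF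
  simp only [F, Finset.mem_filter, Finset.mem_univ, true_and] at hXF hmin
  obtain ⟨hXt, hXi, x, hxX, hxR⟩ := hXF
  have hlt : missCount R X < missCount R (X \ R i) := by
    refine Finset.card_lt_card (Finset.ssubset_iff_of_subset ?_ |>.2 ⟨i, ?_, ?_⟩)
    · intro j hj
      simp only [Finset.mem_filter, Finset.mem_univ, true_and] at hj ⊢
      exact hj.mono_right Finset.sdiff_subset
    · simp [Finset.disjoint_sdiff]
    · simpa using hXi
  have hlt' : dInD tl hd A₀ X < dInD tl hd A₀ (X \ R i) :=
    hXt ▸ hlt.trans_le (h _ ⟨x, Finset.mem_sdiff.2 ⟨hxX, hxR⟩⟩)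
  obtain ⟨a, ha, ha'⟩ := Finset.exists_mem_notMem_of_card_lt_card hlt'
  simp only [Finset.mem_filter, Finset.mem_sdiff, not_and, not_not] at ha ha'
  obtain ⟨haA, ⟨hhX, hhR⟩, htl⟩ := ha
  have htX : tl a ∈ X := ha' haA hhX
  refine ⟨a, haA, htl htX, hhR, fun Y hY htY hYi => ?_⟩
  by_contra! hle
  have hYt : missCount R Y = dInD tl hd A₀ Y := le_antisymm (h Y ⟨_, hY⟩) hle
  have hmem : hd a ∈ X ∩ Y := Finset.mem_inter.2 ⟨hhX, hY⟩
  have h1 := h (X ∩ Y) ⟨_, hmem⟩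
  have h2 := h (X ∪ Y) ⟨_, Finset.mem_union_left _ hhX⟩
  have h3 := dInD_inter_add_union_le tl hd A₀ X Y
  have h4 := missCount_add_le R X Y
  have hmeet : ¬ Disjoint (R i) (X ∩ Y) := fun hd0 => by
    have := missCount_add_lt R X Y i hXi hYi hd0
    omega
  have h5 := hmin (X ∩ Y) ⟨by omega, hmeet, _, hmem, hhR⟩
  have h6 : (X ∩ Y).card < X.card :=
    Finset.card_lt_card (Finset.ssubset_iff_of_subset Finset.inter_subset_left |>.2
      ⟨_, htX, fun hc => htY (Finset.mem_inter.1 hc).2⟩)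
  omega

variable [Fintype V] [Fintype A] [DecidableEq A] [DecidableEq ι]

/-- Adding to a branching an arc between two of its roots gives a branching. -/
theorem IsBranching.insert {tl hd : A → V} {B : Finset A} (hB : IsBranching tl hd B) {a : A}
    (ht : tl a ∈ roots hd B) (hh : hd a ∈ roots hd B) (hne : tl a ≠ hd a) :
    IsBranching tl hd (insert a B) := by
  simp only [roots, Finset.mem_filter, Finset.mem_univ, true_and] at ht hh
  have no_in : ∀ x, ¬ DStep tl hd (Insert.insert a B) x (tl a) := by
    rintro x ⟨b, hb, -, hbu⟩
    rcases Finset.mem_insert.1 hb with rfl | hb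
    · exact hne hbu.symm
    · exact ht b hb hbu
  have not_end : ∀ x, ¬ Relation.TransGen (DStep tl hd (Insert.insert a B)) x (tl a) := by
    intro x h
    obtain ⟨y, -, hy⟩ := Relation.TransGen.tail'_iff.1 h
    exact no_in y hy
  have step : ∀ x y, x ≠ tl a → DStep tl hd (Insert.insert a B) x y → DStep tl hd B x y := by
    rintro x y hx ⟨b, hb, hbx, hby⟩
    rcases Finset.mem_insert.1 hb with rfl | hb
    · exact absurd hbx.symm hx
    · exact ⟨b, hb, hbx, hby⟩
  refine ⟨?_, ?_⟩
  · intro b hb c hc h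
    rcases Finset.mem_insert.1 hb with hba | hb <;> rcases Finset.mem_insert.1 hc with hca | hc
    · rw [hba, hca]
    · exact absurd (hba ▸ h.symm) (hh c hc)
    · exact absurd (hca ▸ h) (hh b hb)
    · exact hB.1 b hb c hc h
  · intro v hv
    have hvu : v ≠ tl a := by
      rintro rfl
      exact not_end _ hv
    have key : ∀ y, Relation.TransGen (DStep tl hd (Insert.insert a B)) v y →
        Relation.TransGen (DStep tl hd B) v y := by
      intro y h
      induction h with
      | single h => exact .single (step _ _ hvu h)
      | @tail y z hy hz ih =>
        refine ih.tail (step _ _ ?_ hz)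
        rintro rfl
        exact not_end _ hy
    exact hB.2 v (key v hv)

/-- **Edmonds' disjoint branchings theorem** (sufficiency), by Lovász's argument. -/
theorem exists_disjoint_branchings (tl hd : A → V) (A₀ : Finset A) (R : ι → Finset V)
    (h : ∀ X : Finset V, X.Nonempty → missCount R X ≤ dInD tl hd A₀ X) :
    ∃ B : ι → Finset A, (∀ i, B i ⊆ A₀) ∧ (∀ i, IsBranching tl hd (B i)) ∧
      (∀ i j, i ≠ j → Disjoint (B i) (B j)) ∧ ∀ i, roots hd (B i) = R i := by
  induction hn : ∑ i, (R i)ᶜ.card using Nat.strong_induction_on generalizing A₀ R with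
  | _ n ih =>
  by_cases hall : ∀ i, R i = Finset.univ
  · refine ⟨fun _ => ∅, by simp, fun _ => ⟨by simp, fun v hv => ?_⟩, by simp, fun i => ?_⟩
    · obtain ⟨y, -, a, ha, -⟩ := Relation.TransGen.tail'_iff.1 hv
      simp at ha
    · simp [roots, hall]
  · push Not at hall
    obtain ⟨i, hi⟩ := hall
    obtain ⟨a, haA, hta, hha, hsp⟩ := exists_spare_arc tl hd A₀ R h i hi
    have hne : tl a ≠ hd a := fun e => hha (e ▸ hta)
    let R' : ι → Finset V := Function.update R i (insert (hd a) (R i))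
    have hR'i : R' i = insert (hd a) (R i) := by simp [R']
    have hR'j : ∀ j, j ≠ i → R' j = R j := fun j hj => by simp [R', hj]
    have hsub : ∀ j, R j ⊆ R' j := by
      intro j
      rcases eq_or_ne j i with rfl | hj
      · rw [hR'i]; exact Finset.subset_insert _ _
      · rw [hR'j j hj]
    have hmono : ∀ X, missCount R' X ≤ missCount R X := by
      intro X
      refine Finset.card_le_card fun j hj => ?_
      simp only [Finset.mem_filter, Finset.mem_univ, true_and] at hj ⊢
      exact hj.mono_left (hsub j)
    have hcond : ∀ X : Finset V, X.Nonempty →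
        missCount R' X ≤ dInD tl hd (A₀.erase a) X := by
      intro X hX
      have h0 := h X hX
      have h1 := hmono X
      rw [show dInD tl hd (A₀.erase a) X = ((A₀.filter fun a => hd a ∈ X ∧ tl a ∉ X).erase a).card
        from congrArg _ (Finset.filter_erase _ _ _)]
      by_cases hent : hd a ∈ X ∧ tl a ∉ X
      · rw [Finset.card_erase_of_mem (Finset.mem_filter.2 ⟨haA, hent⟩)]
        change _ ≤ dInD tl hd A₀ X - 1
        by_cases hdis : Disjoint (R i) X
        · have : missCount R' X < missCount R X := by
            refine Finset.card_lt_card (Finset.ssubset_iff_of_subset ?_ |>.2 ⟨i, ?_, ?_⟩)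
            · intro j hj
              simp only [Finset.mem_filter, Finset.mem_univ, true_and] at hj ⊢
              exact hj.mono_left (hsub j)
            · simpa using hdis
            · simp [hR'i, Finset.disjoint_insert_left, hent.1]
          omega
        · have := hsp X hent.1 hent.2 hdis
          omega
      · have hnot : a ∉ A₀.filter fun a => hd a ∈ X ∧ tl a ∉ X := by simp [hent]
        rw [Finset.erase_eq_of_notMem hnot]
        exact h1.trans h0
    have hdec : ∑ j, (R' j)ᶜ.card < n := by
      rw [← hn]
      refine Finset.sum_lt_sum (fun j _ => Finset.card_le_card
        (Finset.compl_subset_compl.2 (hsub j))) ⟨i, Finset.mem_univ i, ?_⟩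
      refine Finset.card_lt_card (Finset.ssubset_iff_of_subset
        (Finset.compl_subset_compl.2 (hsub i)) |>.2 ⟨hd a, ?_, ?_⟩)
      · simpa using hha
      · simp [hR'i]
    obtain ⟨B, hBA, hBb, hBd, hBr⟩ := ih _ hdec (A₀.erase a) R' hcond rfl
    have hBa : ∀ j, a ∉ B j := fun j hj => Finset.notMem_erase a A₀ (hBA j hj)
    have hBi : ∀ j, j ≠ i → Function.update B i (insert a (B i)) j = B j :=
      fun j hj => by simp [hj]
    refine ⟨Function.update B i (insert a (B i)), ?_, ?_, ?_, ?_⟩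
    · intro j
      rcases eq_or_ne j i with rfl | hj
      · rw [Function.update_self]
        exact Finset.insert_subset haA ((hBA j).trans (Finset.erase_subset _ _))
      · rw [hBi j hj]
        exact (hBA j).trans (Finset.erase_subset _ _)
    · intro j
      rcases eq_or_ne j i with rfl | hj
      · rw [Function.update_self]
        refine (hBb j).insert ?_ ?_ hne
        · rw [hBr, hR'i]; exact Finset.mem_insert_of_mem hta
        · rw [hBr, hR'i]; exact Finset.mem_insert_self _ _
      · rw [hBi j hj]; exact hBb j
    · intro j l hjl
      rcases eq_or_ne j i with rfl | hj
      · rw [Function.update_self, hBi l hjl.symm, Finset.disjoint_insert_left]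
        exact ⟨hBa l, hBd _ _ hjl⟩
      · rw [hBi j hj]
        rcases eq_or_ne l i with rfl | hl
        · rw [Function.update_self, Finset.disjoint_insert_right]
          exact ⟨hBa j, hBd _ _ hjl⟩
        · rw [hBi l hl]; exact hBd _ _ hjl
    · intro j
      rcases eq_or_ne j i with rfl | hj
      · rw [Function.update_self]
        have hr := hBr j
        rw [hR'i] at hr
        ext v
        have hv := Finset.ext_iff.1 hr v
        simp only [roots, Finset.mem_filter, Finset.mem_univ, true_and, Finset.mem_insert,
          forall_eq_or_imp] at hv ⊢
        rw [hv]
        constructor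
        · rintro ⟨h1, rfl | h2⟩
          · exact absurd rfl h1
          · exact h2
        · intro h2
          exact ⟨fun e => hha (e ▸ h2), Or.inr h2⟩
      · rw [hBi j hj, hBr, hR'j j hj]

theorem IsBranching.card_add_card_roots {tl hd : A → V} {B : Finset A}
    (hB : IsBranching tl hd B) : B.card + (roots hd B).card = Fintype.card V := by
  have h : roots hd B = (B.image hd)ᶜ := by
    ext v
    simp [roots]
  rw [h, Finset.card_compl, Finset.card_image_of_injOn (fun a ha b hb e => hB.1 a ha b hb e)]
  have : B.card ≤ Fintype.card V := by
    rw [← Finset.card_image_of_injOn (s := B) (f := hd) (fun a ha b hb e => hB.1 a ha b hb e)]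
    exact Finset.card_le_univ _
  omega

/-- Edmonds' theorem when the number of arcs forces the branchings to use all of them. -/
theorem exists_partition_into_branchings (tl hd : A → V) (A₀ : Finset A) (R : ι → Finset V)
    (h : ∀ X : Finset V, X.Nonempty → missCount R X ≤ dInD tl hd A₀ X)
    (hcard : A₀.card + ∑ i, (R i).card = Fintype.card ι * Fintype.card V) :
    ∃ B : ι → Finset A, (∀ i, IsBranching tl hd (B i)) ∧
      (∀ i j, i ≠ j → Disjoint (B i) (B j)) ∧ Finset.univ.biUnion B = A₀ ∧
      ∀ i, roots hd (B i) = R i := by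
  obtain ⟨B, hBA, hBb, hBd, hBr⟩ := exists_disjoint_branchings tl hd A₀ R h
  refine ⟨B, hBb, hBd, ?_, hBr⟩
  refine Finset.eq_of_subset_of_card_le (Finset.biUnion_subset.2 fun i _ => hBA i) ?_
  rw [Finset.card_biUnion fun i _ j _ hij => hBd i j hij]
  have hsum : ∑ i, ((B i).card + (R i).card) = Fintype.card ι * Fintype.card V := by
    rw [Finset.sum_congr rfl fun i _ => by rw [← hBr i, (hBb i).card_add_card_roots]]
    simp
  rw [Finset.sum_add_distrib] at hsum
  omega

/-- A nonempty set containing no root of a branching is entered by an arc of that branching. -/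
theorem IsBranching.dInD_pos {tl hd : A → V} {B : Finset A} (hB : IsBranching tl hd B)
    {X : Finset V} (hX : X.Nonempty) (hR : Disjoint (roots hd B) X) : 0 < dInD tl hd B X := by
  have : IsTrans V (Relation.TransGen (DStep tl hd B)) := ⟨fun _ _ _ => Relation.TransGen.trans⟩
  have : Std.Irrefl (Relation.TransGen (DStep tl hd B)) := ⟨hB.2⟩
  have wf := Finite.wellFounded_of_trans_of_irrefl (Relation.TransGen (DStep tl hd B))
  obtain ⟨v, hvX, hv⟩ := wf.has_min (X : Set V) hX
  have hnr : v ∉ roots hd B := fun hr => Finset.disjoint_left.1 hR hr hvX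
  simp only [roots, Finset.mem_filter, Finset.mem_univ, true_and, not_forall, not_not] at hnr
  obtain ⟨a, ha, rfl⟩ := hnr
  refine Finset.card_pos.2 ⟨a, Finset.mem_filter.2 ⟨ha, hvX, fun ht => ?_⟩⟩
  exact hv _ ht (.single ⟨a, ha, rfl, rfl⟩)

/-- If `B` has more roots than `C`, some root of `B` which is not a root of `C` can be given up by
`B`: every set containing it which is not entered by an arc contains another root of `B`. -/
theorem exists_movable_root {tl hd : A → V} {B C : Finset A} (hB : IsBranching tl hd B)
    (hC : IsBranching tl hd C) (hlt : (roots hd C).card < (roots hd B).card) :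
    ∃ r ∈ roots hd B, r ∉ roots hd C ∧ ∀ X : Finset V, r ∈ X → dInD tl hd (B ∪ C) X = 0 →
      ∃ s ∈ roots hd B, s ∈ X ∧ s ≠ r := by
  have hit : ∀ {E : Finset A}, IsBranching tl hd E → E ⊆ B ∪ C → ∀ X : Finset V, X.Nonempty →
      dInD tl hd (B ∪ C) X = 0 → ∃ s ∈ roots hd E, s ∈ X := by
    intro E hE hsub X hX h0
    by_contra! hno
    have hpos := hE.dInD_pos hX (Finset.disjoint_left.2 hno)
    have : dInD tl hd E X ≤ dInD tl hd (B ∪ C) X :=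
      Finset.card_le_card (Finset.filter_subset_filter _ hsub)
    omega
  by_contra! hbad
  have hbad' : ∀ r, r ∈ roots hd B \ roots hd C → ∃ X : Finset V, ∃ q, r ∈ X ∧
      dInD tl hd (B ∪ C) X = 0 ∧ (∀ s ∈ roots hd B, s ∈ X → s = r) ∧ q ∈ roots hd C ∧ q ∈ X := by
    intro r hr
    obtain ⟨hrB, hrC⟩ := Finset.mem_sdiff.1 hr
    obtain ⟨X, hrX, h0, hX⟩ := hbad r hrB hrC
    obtain ⟨q, hq, hqX⟩ := hit hC Finset.subset_union_right X ⟨r, hrX⟩ h0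
    exact ⟨X, q, hrX, h0, hX, hq, hqX⟩
  choose! X q hrX h0 huniq hqC hqX using hbad'
  have hle : (roots hd B \ roots hd C).card ≤ (roots hd C \ roots hd B).card := by
    refine Finset.card_le_card_of_injOn q (fun r hr => ?_) (fun r hr s hs hqe => ?_)
    · refine Finset.mem_coe.2 (Finset.mem_sdiff.2 ⟨hqC r hr, fun hqB => ?_⟩)
      have := huniq r hr _ hqB (hqX r hr)
      exact (Finset.mem_sdiff.1 hr).2 (this ▸ hqC r hr)
    · have hmem : q r ∈ X r ∩ X s := Finset.mem_inter.2 ⟨hqX r hr, hqe ▸ hqX s hs⟩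
      have hsub := dInD_inter_add_union_le tl hd (B ∪ C) (X r) (X s)
      rw [h0 r hr, h0 s hs] at hsub
      obtain ⟨t, htB, ht⟩ := hit hB Finset.subset_union_left _ ⟨_, hmem⟩ (by omega)
      obtain ⟨htr, hts⟩ := Finset.mem_inter.1 ht
      rw [← huniq r hr t htB htr, huniq s hs t htB hts]
  have h1 := Finset.card_sdiff_add_card_inter (roots hd B) (roots hd C)
  have h2 := Finset.card_sdiff_add_card_inter (roots hd C) (roots hd B)
  rw [Finset.inter_comm] at h2
  omega

/-- A root can be moved from a branching to another one with fewer roots. -/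
theorem exists_rebalanced_pair {tl hd : A → V} {B C : Finset A} (hB : IsBranching tl hd B)
    (hC : IsBranching tl hd C) (hdisj : Disjoint B C)
    (hlt : (roots hd C).card < (roots hd B).card) :
    ∃ B' C' : Finset A, IsBranching tl hd B' ∧ IsBranching tl hd C' ∧ Disjoint B' C' ∧
      B' ∪ C' = B ∪ C ∧ (roots hd B').card + 1 = (roots hd B).card ∧
      (roots hd C').card = (roots hd C).card + 1 := by
  obtain ⟨r, hrB, hrC, hr⟩ := exists_movable_root hB hC hlt
  have hcard : ((roots hd B).erase r).card + 1 = (roots hd B).card :=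
    Finset.card_erase_add_one hrB
  have hcard' : (insert r (roots hd C)).card = (roots hd C).card + 1 :=
    Finset.card_insert_of_notMem hrC
  obtain ⟨E, hEb, hEd, hEu, hEr⟩ := exists_partition_into_branchings tl hd (B ∪ C)
    (fun b : Bool => cond b ((roots hd B).erase r) (insert r (roots hd C))) (by
      intro X hX
      have hBX := fun h => hB.dInD_pos hX h
      have hCX := fun h => hC.dInD_pos hX h
      have hrX := hr X
      rw [missCount_bool]
      rw [dInD_union tl hd hdisj] at hrX ⊢
      by_cases hmem : r ∈ X
      · have hno : ¬ Disjoint (insert r (roots hd C)) X := by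
          simp [Finset.disjoint_insert_left, hmem]
        rw [if_neg hno]
        by_cases h0 : dInD tl hd B X + dInD tl hd C X = 0
        · obtain ⟨s, hs, hsX, hsr⟩ := hrX hmem h0
          rw [if_neg fun hd0 => Finset.disjoint_left.1 hd0 (Finset.mem_erase.2 ⟨hsr, hs⟩) hsX]
          omega
        · split_ifs <;> omega
      · have e1 : Disjoint ((roots hd B).erase r) X ↔ Disjoint (roots hd B) X := by
          rw [← Finset.disjoint_insert_left.trans (and_iff_right hmem), Finset.insert_erase hrB]
        have e2 : Disjoint (insert r (roots hd C)) X ↔ Disjoint (roots hd C) X :=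
          Finset.disjoint_insert_left.trans (and_iff_right hmem)
        simp only [e1, e2]
        by_cases h1 : Disjoint (roots hd B) X <;> by_cases h2 : Disjoint (roots hd C) X <;>
          simp only [h1, h2, if_true, if_false]
        · have := hBX h1
          have := hCX h2
          omega
        · have := hBX h1
          omega
        · have := hCX h2
          omega
        · omega) (by
      have h1 := hB.card_add_card_roots
      have h2 := hC.card_add_card_roots
      rw [Finset.card_union_of_disjoint hdisj, Fintype.sum_bool, Fintype.card_bool]
      simp only [cond_true, cond_false]
      omega)
  refine ⟨E true, E false, hEb _, hEb _, hEd _ _ (by simp), ?_, ?_, ?_⟩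
  · rw [← hEu]
    ext a
    simp [or_comm]
  · rw [hEr]; exact hcard
  · rw [hEr]; exact hcard'

/-- A digraph with in-degrees at most `k` and fractional arboricity at most `k` decomposes into `k`
branchings. -/
theorem exists_branching_decomposition (tl hd : A → V) (k : ℕ)
    (hindeg : ∀ v : V, (Finset.univ.filter fun a : A => hd a = v).card ≤ k)
    (harbor : ∀ X : Finset V, X.Nonempty →
        (Finset.univ.filter fun a : A => tl a ∈ X ∧ hd a ∈ X).card ≤ k * (X.card - 1)) :
    ∃ B : Fin k → Finset A, (∀ i, IsBranching tl hd (B i)) ∧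
      (∀ i j, i ≠ j → Disjoint (B i) (B j)) ∧
      Finset.univ.biUnion B = (Finset.univ : Finset A) := by
  let m : V → ℕ := fun v => k - (Finset.univ.filter fun a : A => hd a = v).card
  let tl' : A ⊕ (Σ v : V, Fin (m v)) → Option V := Sum.elim (fun a => some (tl a)) fun _ => none
  let hd' : A ⊕ (Σ v : V, Fin (m v)) → Option V :=
    Sum.elim (fun a => some (hd a)) fun p => some p.1
  have hsum : ∀ Y : Finset V, (Finset.univ.filter fun a : A => hd a ∈ Y).card +
      ∑ v ∈ Y, m v = k * Y.card := by
    intro Y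
    have h1 : (Finset.univ.filter fun a : A => hd a ∈ Y).card =
        ∑ v ∈ Y, (Finset.univ.filter fun a : A => hd a = v).card := by
      rw [Finset.card_eq_sum_card_fiberwise (f := hd) (t := Y) (fun a ha => by simpa using ha)]
      refine Finset.sum_congr rfl fun v hv => congrArg _ ?_
      ext a
      simp only [Finset.mem_filter, Finset.mem_univ, true_and]
      exact ⟨And.right, fun e => ⟨e ▸ hv, e⟩⟩
    rw [h1, ← Finset.sum_add_distrib, Finset.sum_congr rfl fun v _ =>
      Nat.add_sub_of_le (hindeg v)]
    simp [mul_comm]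
  obtain ⟨B, hBb, hBd, hBu, -⟩ := exists_partition_into_branchings tl' hd' Finset.univ
    (fun _ : Fin k => {none}) (by
      intro X hX
      by_cases hnone : none ∈ X
      · simp [missCount, hnone]
      let Y : Finset V := Finset.univ.filter fun v => some v ∈ X
      have hY : Y.Nonempty := by
        obtain ⟨x, hx⟩ := hX
        cases x with
        | none => exact absurd hx hnone
        | some v => exact ⟨v, by simpa [Y] using hx⟩
      have h1 : missCount (fun _ : Fin k => ({none} : Finset (Option V))) X ≤ k :=
        (Finset.card_le_univ _).trans (by simp)
      have h2 : dInD tl' hd' Finset.univ X =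
          (Finset.univ.filter fun a : A => hd a ∈ Y ∧ tl a ∉ Y).card + ∑ v ∈ Y, m v := by
        rw [dInD, Finset.card_filter, Fintype.sum_sum_type, ← Finset.card_filter,
          Fintype.sum_sigma]
        simp [tl', hd', Y, hnone, Finset.sum_filter]
        congr
      have h3 : (Finset.univ.filter fun a : A => hd a ∈ Y).card =
          (Finset.univ.filter fun a : A => tl a ∈ Y ∧ hd a ∈ Y).card +
          (Finset.univ.filter fun a : A => hd a ∈ Y ∧ tl a ∉ Y).card := by
        rw [← Finset.card_filter_add_card_filter_not (fun a : A => tl a ∈ Y),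
          Finset.filter_filter, Finset.filter_filter]
        simp only [and_comm]
      have h4 := harbor Y hY
      have h5 := hsum Y
      obtain ⟨n, hn⟩ := Nat.exists_eq_add_of_lt hY.card_pos
      rw [hn] at h4 h5
      simp only [zero_add, Nat.add_sub_cancel, Nat.mul_add, mul_one] at h4 h5
      omega) (by
      have h5 := hsum Finset.univ
      simp only [Finset.mem_univ, Finset.filter_true, Finset.card_univ] at h5
      simp only [Finset.card_univ, Fintype.card_sum, Fintype.card_sigma, Fintype.card_fin,
        Finset.card_singleton, Finset.sum_const, Fintype.card_option, h5, smul_eq_mul]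
      ring)
  refine ⟨fun i => Finset.univ.filter fun a => Sum.inl a ∈ B i, fun i => ⟨?_, ?_⟩, ?_, ?_⟩
  · intro a ha b hb e
    refine Sum.inl_injective ((hBb i).1 _ (by simpa using ha) _ (by simpa using hb) ?_)
    simp [hd', e]
  · intro v hv
    refine (hBb i).2 (some v) (Relation.TransGen.lift some ?_ _ _ hv)
    rintro x y ⟨a, ha, rfl, rfl⟩
    exact ⟨Sum.inl a, by simpa using ha, rfl, rfl⟩
  · intro i j hij
    refine Finset.disjoint_left.2 fun a ha hb => ?_
    exact Finset.disjoint_left.1 (hBd i j hij) (by simpa using ha) (by simpa using hb)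
  · ext a
    have := hBu ▸ Finset.mem_univ (Sum.inl a : A ⊕ (Σ v : V, Fin (m v)))
    simpa using this

/-- If integers sum up to `c` and differ by at most one, each is a rounding of their average. -/
theorem eq_div_or_eq_ceil_div_of_sum_eq {k : ℕ} (f : Fin k → ℕ) (c : ℕ) (hsum : ∑ i, f i = c)
    (hbal : ∀ i j, f i ≤ f j + 1) (i : Fin k) :
    f i = c / k ∨ f i = (c + k - 1) / k := by
  have hk : 0 < k := i.pos
  obtain ⟨j, -, hj⟩ := Finset.exists_min_image Finset.univ f ⟨i, Finset.mem_univ i⟩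
  have hlow : k * f j ≤ c := by
    rw [← hsum]
    simpa using Finset.card_nsmul_le_sum Finset.univ f (f j) fun l _ => hj l (Finset.mem_univ l)
  have hup : c < k * (f j + 1) := by
    rw [← hsum]
    have : ∑ l, f l < ∑ _l : Fin k, (f j + 1) :=
      Finset.sum_lt_sum (fun l _ => hbal l j) ⟨j, Finset.mem_univ j, Nat.lt_succ_self _⟩
    simpa using this
  rcases Nat.lt_or_ge (f j) (f i) with hlt | hge
  · right
    have hi : f i = f j + 1 := le_antisymm (hbal i j) hlt
    have hlow' : k * f j < c := by
      rw [← hsum]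
      have : ∑ _l : Fin k, f j < ∑ l, f l :=
        Finset.sum_lt_sum (fun l _ => hj l (Finset.mem_univ l)) ⟨i, Finset.mem_univ i, hlt⟩
      simpa using this
    rw [hi]
    refine (Nat.div_eq_of_lt_le ?_ ?_).symm <;> grind
  · left
    have hi : f i = f j := le_antisymm hge (hj i (Finset.mem_univ i))
    rw [hi]
    refine (Nat.div_eq_of_lt_le ?_ ?_).symm <;> grind

end DisjointBranchings

/-- **Corollary (balanced decomposition into `k` branchings).**
If `Δ⁻(D) ≤ k` and the fractional arboricity of `D` is at most `k` (i.e. every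
nonempty `X ⊆ V` induces at most `k(|X|−1)` arcs), then, with
`c = k|V(D)| − |E(D)|`, the arc set of `D` can be partitioned into `k`
branchings each having exactly `⌊c/k⌋` or exactly `⌈c/k⌉` roots. -/
theorem balanced_decomposition_into_branchings
    {V A : Type} [Fintype V] [DecidableEq V] [Fintype A] [DecidableEq A]
    (tl hd : A → V) (hloop : ∀ a, tl a ≠ hd a)
    (k : ℕ) (hk : 0 < k)
    (hindeg : ∀ v : V, (Finset.univ.filter fun a : A => hd a = v).card ≤ k)
    (harbor : ∀ X : Finset V, X.Nonempty →
        (Finset.univ.filter fun a : A => tl a ∈ X ∧ hd a ∈ X).card ≤ k * (X.card - 1))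
    (c : ℕ) (hc : (c : ℤ) = (k : ℤ) * (Fintype.card V : ℤ) - (Fintype.card A : ℤ)) :
    ∃ B : Fin k → Finset A,
      (∀ i, IsBranching tl hd (B i)) ∧
      (∀ i j, i ≠ j → Disjoint (B i) (B j)) ∧
      Finset.univ.biUnion B = (Finset.univ : Finset A) ∧
      (∀ i, (roots hd (B i)).card = c / k ∨ (roots hd (B i)).card = (c + k - 1) / k) := by
  let P : (Fin k → Finset A) → Prop := fun B => (∀ i, IsBranching tl hd (B i)) ∧
    (∀ i j, i ≠ j → Disjoint (B i) (B j)) ∧ Finset.univ.biUnion B = (Finset.univ : Finset A)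
  have hne : {B | P B}.Nonempty := exists_branching_decomposition tl hd k hindeg harbor
  obtain ⟨B, ⟨hBb, hBd, hBu⟩, hmin⟩ := Set.exists_min_image {B | P B}
    (fun B => ∑ i, (roots hd (B i)).card ^ 2) (Set.toFinite _) hne
  refine ⟨B, hBb, hBd, hBu,
    eq_div_or_eq_ceil_div_of_sum_eq (fun i => (roots hd (B i)).card) c ?_ ?_⟩
  · have h1 : ∑ i, ((B i).card + (roots hd (B i)).card) = k * Fintype.card V := by
      rw [Finset.sum_congr rfl fun i _ => (hBb i).card_add_card_roots]
      simp
    rw [Finset.sum_add_distrib, ← Finset.card_biUnion fun i _ j _ hij => hBd i j hij, hBu,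
      Finset.card_univ] at h1
    zify at h1 ⊢
    linarith
  · intro i j
    by_contra! hlt
    have hij : i ≠ j := by
      rintro rfl
      omega
    obtain ⟨E, F, hE, hF, hEF, hu, hcE, hcF⟩ :=
      exists_rebalanced_pair (hBb i) (hBb j) (hBd i j hij) (by omega)
    let B' : Fin k → Finset A := Function.update (Function.update B i E) j F
    have hj : B' j = F := by simp [B']
    have hi : B' i = E := by simp [B', hij]
    have ho : ∀ l, l ≠ i → l ≠ j → B' l = B l := fun l h1 h2 => by simp [B', h1, h2]
    have hsubE : ∀ l, l ≠ i → l ≠ j → Disjoint (E ∪ F) (B l) := fun l h1 h2 => by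
      rw [hu]
      exact Finset.disjoint_union_left.2 ⟨hBd _ _ h1.symm, hBd _ _ h2.symm⟩
    have hP : P B' := by
      refine ⟨fun l => ?_, fun l n hln => ?_, ?_⟩
      · by_cases h1 : l = i
        · rw [h1, hi]; exact hE
        by_cases h2 : l = j
        · rw [h2, hj]; exact hF
        rw [ho l h1 h2]; exact hBb l
      · have hother : ∀ l, l ≠ i → l ≠ j → Disjoint E (B l) ∧ Disjoint F (B l) :=
          fun l h1 h2 => Finset.disjoint_union_left.1 (hsubE l h1 h2)
        by_cases h1 : l = i <;> by_cases h2 : l = j <;> by_cases h3 : n = i <;>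
          by_cases h4 : n = j <;> grind
      · refine Finset.eq_univ_iff_forall.2 fun a => ?_
        obtain ⟨l, -, hl⟩ := Finset.mem_biUnion.1 (hBu ▸ Finset.mem_univ a)
        have hmem : ∃ n, a ∈ B' n := by
          by_cases h12 : l = i ∨ l = j
          · have : a ∈ E ∪ F := by
              rw [hu]
              rcases h12 with rfl | rfl
              · exact Finset.mem_union_left _ hl
              · exact Finset.mem_union_right _ hl
            rcases Finset.mem_union.1 this with h | h
            · exact ⟨i, hi ▸ h⟩
            · exact ⟨j, hj ▸ h⟩
          · push Not at h12
            exact ⟨l, ho l h12.1 h12.2 ▸ hl⟩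
        obtain ⟨n, hn⟩ := hmem
        exact Finset.mem_biUnion.2 ⟨n, Finset.mem_univ n, hn⟩
    have hle := hmin B' hP
    have hsplit : ∀ f : Fin k → ℕ,
        ∑ l, f l = f i + (f j + ∑ l ∈ (Finset.univ.erase i).erase j, f l) := fun f => by
      rw [Finset.add_sum_erase _ f (Finset.mem_erase.2 ⟨hij.symm, Finset.mem_univ j⟩),
        Finset.add_sum_erase _ f (Finset.mem_univ i)]
    have hrest : ∑ l ∈ (Finset.univ.erase i).erase j, (roots hd (B' l)).card ^ 2 =
        ∑ l ∈ (Finset.univ.erase i).erase j, (roots hd (B l)).card ^ 2 :=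
      Finset.sum_congr rfl fun l hl => by rw [ho l (by grind) (by grind)]
    rw [hsplit, hsplit fun l => (roots hd (B' l)).card ^ 2, hi, hj, hrest, hcF, ← hcE] at hle
    nlinarith
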